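/- Let c>0 and κ>1. Then there exists a constant C>0, depending only on κ and c, such that the following holds: if φ,ψ:ℝ³→ℝ are smooth and u* is a smooth solution of ∂_t²u*−c²Δ_x u*=0 on (0,∞)×ℝ³ with u*(0,·)=φ and ∂_t u*(0,·)=ψ, then for every (t,x)∈[0,∞)×ℝ³, ⟨t+|x|⟩·⟨ct−|x|⟩^{κ−1}·|u*(t,x)| ≤ C·sup_{y∈ℝ³, |y−x|≤ct} ⟨|y|⟩^κ·( ⟨|y|⟩·|φ(y)|_1 + |y|·|ψ(y)| ). -/

import Mathlib

noncomputable section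

namespace PaperKatayama

/-- Euclidean 3-space. -/
abbrev E3 := EuclideanSpace ℝ (Fin 3)

/-- Space-time functions. -/
abbrev Fn := ℝ → E3 → ℝ

/-- Functions of the space variable alone. -/
abbrev SFn := E3 → ℝ

/-- The Japanese bracket `⟨a⟩ = √(1+a²)`. -/
def jb (a : ℝ) : ℝ := Real.sqrt (1 + a ^ 2)

/-- Time derivative `∂_t`. -/
def pt (f : Fn) : Fn := fun t x => deriv (fun s => f s x) t

/-- Spatial derivative `∂_j` (j = 1,2,3, here indexed by `Fin 3`). -/
def pd (j : Fin 3) (f : Fn) : Fn :=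
  fun t x => fderiv ℝ (f t) x (EuclideanSpace.single j 1)

/-- `∂_a` for `a ∈ {0,1,2,3}`, with `∂_0 = ∂_t`. -/
def pda (a : Fin 4) : Fn → Fn := Fin.cases pt (fun j => pd j) a

/-- Rotation field `Ω_{jk} = x_j ∂_k − x_k ∂_j`, extended antisymmetrically
(so `rotA k j = − rotA j k`, and `rotA j j = 0`). -/
def rotA (j k : Fin 3) (f : Fn) : Fn :=
  fun t x => x j * pd k f t x - x k * pd j f t x

/-- Radial derivative `∂_r = Σ_j (x_j/r) ∂_j`. -/
def pr (f : Fn) : Fn := fun t x => ∑ j, (x j / ‖x‖) * pd j f t x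

/-- `D_{+,c} = ∂_t + c ∂_r`. -/
def Dp (c : ℝ) (f : Fn) : Fn := fun t x => pt f t x + c * pr f t x

/-- `D_{−,c} = ∂_t − c ∂_r`. -/
def Dm (c : ℝ) (f : Fn) : Fn := fun t x => pt f t x - c * pr f t x

/-- The seven fields `Z = {∂_t, ∂_1, ∂_2, ∂_3, Ω_{12}, Ω_{13}, Ω_{23}}`. -/
def Zop : Fin 7 → Fn → Fn :=
  ![pt, pd 0, pd 1, pd 2, rotA 0 1, rotA 0 2, rotA 1 2]

/-- `Z^α = Z_1^{α_1} ⋯ Z_7^{α_7}`. -/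
def Zpow (α : Fin 7 → ℕ) (f : Fn) : Fn :=
  (Zop 0)^[α 0] <| (Zop 1)^[α 1] <| (Zop 2)^[α 2] <| (Zop 3)^[α 3] <|
    (Zop 4)^[α 4] <| (Zop 5)^[α 5] <| (Zop 6)^[α 6] f

/-- Multi-indices `α` (for the seven fields) with `|α| ≤ s`. -/
def multiIdx (s : ℕ) : Finset (Fin 7 → ℕ) :=
  (Fintype.piFinset fun _ => Finset.range (s + 1)).filter fun α => ∑ i, α i ≤ s

/-- `|v(t,x)|_s = Σ_{|α| ≤ s} |Z^α v(t,x)|`. -/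
def vnorm (s : ℕ) (f : Fn) (t : ℝ) (x : E3) : ℝ :=
  ∑ α ∈ multiIdx s, |Zpow α f t x|

/-- Smoothness of a space-time function. -/
def Smooth (f : Fn) : Prop := ContDiff ℝ (⊤ : ℕ∞) (fun p : ℝ × E3 => f p.1 p.2)

/-- `u` is a smooth solution of `∂_t²u − c²Δu = G` on `(0,∞)×ℝ³`
with zero initial data. -/
def IsWaveSol (c : ℝ) (G u : Fn) : Prop :=
  Smooth u ∧
    (∀ t x, 0 < t → pt (pt u) t x - c ^ 2 * ∑ j, pd j (pd j u) t x = G t x) ∧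
    (∀ x, u 0 x = 0) ∧ (∀ x, pt u 0 x = 0)

/-- `u` is a smooth solution of the free wave equation `∂_t²u − c²Δu = 0`
on `(0,∞)×ℝ³` with initial data `φ, ψ`. -/
def IsFreeWaveSol (c : ℝ) (φ ψ : SFn) (u : Fn) : Prop :=
  Smooth u ∧
    (∀ t x, 0 < t → pt (pt u) t x - c ^ 2 * ∑ j, pd j (pd j u) t x = 0) ∧
    (∀ x, u 0 x = φ x) ∧ (∀ x, pt u 0 x = ψ x)

/-- Extension of the speeds `c_1, …, c_N` by `c_0 = 0`. -/
def cs0 {N : ℕ} (cs : Fin N → ℝ) : Fin (N + 1) → ℝ := Fin.cases 0 cs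

/-- The weight `w(t,r) = min_{0 ≤ j ≤ N} ⟨c_j t − r⟩` (with `c_0 = 0`). -/
def wgt {N : ℕ} (cs : Fin N → ℝ) (t r : ℝ) : ℝ :=
  Finset.univ.inf' Finset.univ_nonempty fun j : Fin (N + 1) => jb (cs0 cs j * t - r)

/-- The weighted sup `A_{ρ,μ,s}[G;c](t,x)` over the backward cone `Λ_c(t,x)`. -/
def Afun (ρ μ : ℝ) (s : ℕ) (G : Fn) (c : ℝ) {N : ℕ} (cs : Fin N → ℝ)
    (t : ℝ) (x : E3) : ℝ :=
  sSup {a : ℝ | ∃ τ : ℝ, ∃ y : E3, 0 ≤ τ ∧ τ ≤ t ∧ ‖y - x‖ ≤ c * (t - τ) ∧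
    a = ‖y‖ * jb (τ + ‖y‖) ^ ρ * wgt cs τ ‖y‖ ^ (1 + μ) * vnorm s G τ y}

/-- Spatial derivative of a function of `x` alone. -/
def sd (j : Fin 3) (φ : SFn) : SFn :=
  fun x => fderiv ℝ φ x (EuclideanSpace.single j 1)

/-- Spatial rotation field for functions of `x` alone. -/
def srot (j k : Fin 3) (φ : SFn) : SFn :=
  fun x => x j * sd k φ x - x k * sd j φ x

/-- The six spatial fields `{∂_1, ∂_2, ∂_3, Ω_{12}, Ω_{13}, Ω_{23}}`. -/
def Sop : Fin 6 → SFn → SFn :=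
  ![sd 0, sd 1, sd 2, srot 0 1, srot 0 2, srot 1 2]

/-- `Z^α` for the spatial fields. -/
def Spow (α : Fin 6 → ℕ) (φ : SFn) : SFn :=
  (Sop 0)^[α 0] <| (Sop 1)^[α 1] <| (Sop 2)^[α 2] <| (Sop 3)^[α 3] <|
    (Sop 4)^[α 4] <| (Sop 5)^[α 5] φ

/-- Spatial multi-indices with `|α| ≤ s`. -/
def smultiIdx (s : ℕ) : Finset (Fin 6 → ℕ) :=
  (Fintype.piFinset fun _ => Finset.range (s + 1)).filter fun α => ∑ i, α i ≤ s

/-- `|φ(x)|_s` for a function of `x` alone. -/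
def snorm (s : ℕ) (φ : SFn) (x : E3) : ℝ :=
  ∑ α ∈ smultiIdx s, |Spow α φ x|

/-- The weighted sup `B_{ρ,s}[φ,ψ;c](t,x)`. -/
def Bfun (ρ : ℝ) (s : ℕ) (φ ψ : SFn) (c t : ℝ) (x : E3) : ℝ :=
  sSup {b : ℝ | ∃ y : E3, ‖y - x‖ ≤ c * t ∧
    b = jb ‖y‖ ^ ρ * (snorm (s + 1) φ y + snorm s ψ y)}

/-- `Φ_ρ(t,r)`. -/
def Phi (ρ t r : ℝ) : ℝ :=
  if ρ = 0 then Real.log (2 + jb (t + r) / jb (t - r)) else jb (t - r) ^ (-ρ)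

/-- `Ψ_ρ(t)`. -/
def Psi (ρ t : ℝ) : ℝ := if ρ = 0 then Real.log (2 + t) else 1

/-- The null form `Q_0(v,w;c) = (∂_t v)(∂_t w) − c²(∇v)·(∇w)`. -/
def Q0f (c : ℝ) (v w : Fn) : Fn :=
  fun t x => pt v t x * pt w t x - c ^ 2 * ∑ j, pd j v t x * pd j w t x

/-- The null form `Q_{ab}(v,w) = (∂_a v)(∂_b w) − (∂_b v)(∂_a w)`. -/
def Qab (a b : Fin 4) (v w : Fn) : Fn :=
  fun t x => pda a v t x * pda b w t x - pda b v t x * pda a w t x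

/-- Lorentz boost `L_{c,j} = (x_j/c)∂_t + c t ∂_j`. -/
def Lb (c : ℝ) (j : Fin 3) (f : Fn) : Fn :=
  fun t x => (x j / c) * pt f t x + c * t * pd j f t x

/-- Scaling field `S = t ∂_t + x·∇_x`. -/
def Sc (f : Fn) : Fn := fun t x => t * pt f t x + ∑ j, x j * pd j f t x

/-- `v(t,r,ω) = r u(t, rω)`. -/
def Vrad (u : Fn) (ω : E3) (t r : ℝ) : ℝ := r * u t (r • ω)

/-- `(∂_t + ∂_r) v` in the variables `(t,r)` for fixed `ω`. -/
def DpV (u : Fn) (ω : E3) (t r : ℝ) : ℝ :=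
  deriv (fun s => Vrad u ω s r) t + deriv (fun ρ' => Vrad u ω t ρ') r

/-- Cross product in ℝ³. -/
def cross3 (a b : Fin 3 → ℝ) : Fin 3 → ℝ :=
  ![a 1 * b 2 - a 2 * b 1, a 2 * b 0 - a 0 * b 2, a 0 * b 1 - a 1 * b 0]

/-- `Ωv = (Ω_{23}v, −Ω_{13}v, Ω_{12}v)`. -/
def OmegaVec (v : Fn) (t : ℝ) (x : E3) : Fin 3 → ℝ :=
  ![rotA 1 2 v t x, -(rotA 0 2 v t x), rotA 0 1 v t x]

/-- `∂^α` for a multi-index with `|α| ≤ 1`: either the identity or a single `∂_a`. -/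
def Dle1 : Option (Fin 4) → Fn → Fn
  | none => id
  | some a => pda a

/-- A linear combination, with constant real coefficients, of the null forms
`Q_0(u_j, ∂^α u_k; c)` and `Q_{ab}(u_j, ∂^α u_k)` with `0 ≤ a < b ≤ 3`, `|α| ≤ 1`. -/
def NullF (c : ℝ) (m : ℕ)
    (a0 : Fin m → Fin m → Fin m → Option (Fin 4) → ℝ)
    (aQ : Fin m → Fin m → Fin m → Fin 4 → Fin 4 → Option (Fin 4) → ℝ)
    (v : Fin m → Fn) (i : Fin m) : Fn := fun t x =>
  (∑ j, ∑ k, ∑ o : Option (Fin 4), a0 i j k o * Q0f c (v j) (Dle1 o (v k)) t x) +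
    ∑ j, ∑ k, ∑ p ∈ Finset.univ.filter (fun p : Fin 4 × Fin 4 => p.1 < p.2),
      ∑ o : Option (Fin 4), aQ i j k p.1 p.2 o * Qab p.1 p.2 (v j) (Dle1 o (v k)) t x

/-- A divergence-form identity on the box `[0,T] × [0,π] × [0,2π]`. -/
theorem integral_eq_of_divergence_free {T k : ℝ} (hT : 0 ≤ T) {F F' A A' B B' : ℝ → ℝ → ℝ → ℝ}
    (hF : ∀ s p q, HasDerivAt (fun s => F s p q) (F' s p q) s)
    (hA : ∀ s p q, HasDerivAt (fun p => A s p q) (A' s p q) p)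
    (hB : ∀ s p q, HasDerivAt (fun q => B s p q) (B' s p q) q)
    (hF0 : Continuous fun z : ℝ × ℝ × ℝ => F z.1 z.2.1 z.2.2)
    (hF' : Continuous fun z : ℝ × ℝ × ℝ => F' z.1 z.2.1 z.2.2)
    (hA' : Continuous fun z : ℝ × ℝ × ℝ => A' z.1 z.2.1 z.2.2)
    (hB' : Continuous fun z : ℝ × ℝ × ℝ => B' z.1 z.2.1 z.2.2)
    (hdiv : ∀ s ∈ Set.Icc 0 T, ∀ p q, F' s p q = k * (A' s p q + B' s p q))
    (hA0 : ∀ s q, A s 0 q = A s Real.pi q)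
    (hB0 : ∀ s p, B s p 0 = B s p (2 * Real.pi)) :
    ∫ q in 0..2 * Real.pi, ∫ p in 0..Real.pi, F T p q =
      ∫ q in 0..2 * Real.pi, ∫ p in 0..Real.pi, F 0 p q := by
  have swap : ∀ (f : ℝ → ℝ → ℝ) (a b c d : ℝ), Continuous (fun z : ℝ × ℝ => f z.1 z.2) →
      ∫ x in a..b, ∫ y in c..d, f x y = ∫ y in c..d, ∫ x in a..b, f x y := by
    intro f a b c d hf
    apply MeasureTheory.intervalIntegral_intervalIntegral_swap
    exact (hf.continuousOn.integrableOn_compact (isCompact_uIcc.prod isCompact_uIcc)).mono_set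
      (Set.prod_mono Set.uIoc_subset_uIcc Set.uIoc_subset_uIcc)
  have cont : ∀ {X : Type} [TopologicalSpace X] (f : X → ℝ → ℝ) (a b : ℝ),
      Continuous (fun z : X × ℝ => f z.1 z.2) → Continuous fun x => ∫ y in a..b, f x y := by
    intro X _ f a b hf
    exact intervalIntegral.continuous_parametric_intervalIntegral_of_continuous' hf a b
  have slice : ∀ s ∈ Set.Icc 0 T,
      ∫ q in 0..2 * Real.pi, ∫ p in 0..Real.pi, F' s p q = 0 := by
    intro s hs
    have c1 : Continuous fun z : ℝ × ℝ => A' s z.2 z.1 :=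
      hA'.comp (by fun_prop : Continuous fun z : ℝ × ℝ => (s, z.2, z.1))
    have c2 : Continuous fun z : ℝ × ℝ => B' s z.2 z.1 :=
      hB'.comp (by fun_prop : Continuous fun z : ℝ × ℝ => (s, z.2, z.1))
    have c3 : ∀ q, Continuous fun p => A' s p q := fun q =>
      c1.comp (by fun_prop : Continuous fun p : ℝ => (q, p))
    have c4 : ∀ q, Continuous fun p => B' s p q := fun q =>
      c2.comp (by fun_prop : Continuous fun p : ℝ => (q, p))
    have c5 : ∀ p, Continuous fun q => B' s p q := fun p =>
      c2.comp (by fun_prop : Continuous fun q : ℝ => (q, p))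
    have e1 : ∀ q, ∫ p in 0..Real.pi, F' s p q =
        k * ∫ p in 0..Real.pi, B' s p q := by
      intro q
      have : ∫ p in 0..Real.pi, A' s p q = 0 := by
        rw [intervalIntegral.integral_eq_sub_of_hasDerivAt (fun p _ => hA s p q)
          ((c3 q).intervalIntegrable _ _), hA0, sub_self]
      simp_rw [hdiv s hs]
      rw [intervalIntegral.integral_const_mul, intervalIntegral.integral_add
        ((c3 q).intervalIntegrable _ _) ((c4 q).intervalIntegrable _ _), this, zero_add]
    simp_rw [e1]
    rw [intervalIntegral.integral_const_mul, swap _ _ _ _ _ c2]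
    have e2 : ∀ p, ∫ q in 0..2 * Real.pi, B' s p q = 0 := by
      intro p
      rw [intervalIntegral.integral_eq_sub_of_hasDerivAt (fun q _ => hB s p q)
          ((c5 p).intervalIntegrable _ _), hB0, sub_self]
    simp [e2]
  have c0 : ∀ s, Continuous fun z : ℝ × ℝ => F s z.2 z.1 := fun s =>
    hF0.comp (by fun_prop : Continuous fun z : ℝ × ℝ => (s, z.2, z.1))
  have c0' : ∀ s q, Continuous fun p => F s p q := fun s q =>
    (c0 s).comp (by fun_prop : Continuous fun p : ℝ => (q, p))
  rw [← sub_eq_zero, ← intervalIntegral.integral_sub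
    ((cont _ _ _ (c0 T)).intervalIntegrable _ _) ((cont _ _ _ (c0 0)).intervalIntegrable _ _)]
  have e3 : ∀ q, (∫ p in 0..Real.pi, F T p q) - (∫ p in 0..Real.pi, F 0 p q) =
      ∫ s in 0..T, ∫ p in 0..Real.pi, F' s p q := by
    intro q
    rw [swap (fun s p => F' s p q) _ _ _ _
      (hF'.comp (by fun_prop : Continuous fun z : ℝ × ℝ => (z.1, z.2, q))),
      ← intervalIntegral.integral_sub ((c0' T q).intervalIntegrable _ _)
        ((c0' 0 q).intervalIntegrable _ _)]
    refine intervalIntegral.integral_congr fun p _ => ?_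
    rw [intervalIntegral.integral_eq_sub_of_hasDerivAt (fun s _ => hF s p q)]
    exact (hF'.comp (by fun_prop : Continuous fun s : ℝ => (s, p, q))).intervalIntegrable _ _
  simp_rw [e3]
  rw [swap (fun q s => ∫ p in 0..Real.pi, F' s p q) _ _ _ _
    (cont (fun (z : ℝ × ℝ) p => F' z.2 p z.1) _ _
      (hF'.comp (by fun_prop : Continuous fun z : (ℝ × ℝ) × ℝ => (z.1.2, z.2, z.1.1))))]
  rw [intervalIntegral.integral_congr (g := fun _ => (0 : ℝ)) fun s hs => ?_]
  · simp
  · exact slice s (by rwa [Set.uIcc_of_le hT] at hs)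

/-- The trace of a bilinear form does not depend on the orthonormal basis. -/
theorem sum_apply_orthonormalBasis {ι ι' E : Type*} [Fintype ι] [Fintype ι']
    [NormedAddCommGroup E] [InnerProductSpace ℝ E]
    (T : E →ₗ[ℝ] E →ₗ[ℝ] ℝ) (v : OrthonormalBasis ι ℝ E) (w : OrthonormalBasis ι' ℝ E) :
    ∑ i, T (v i) (v i) = ∑ i, T (w i) (w i) := by
  have h : ∀ i, T (v i) (v i) =
      ∑ k, ∑ l, (inner ℝ (w k) (v i) * inner ℝ (v i) (w l)) * T (w k) (w l) := by
    intro i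
    conv_lhs => rw [← w.sum_repr' (v i)]
    simp only [map_sum, map_smul, LinearMap.sum_apply, LinearMap.smul_apply, smul_eq_mul,
      Finset.mul_sum]
    rw [Finset.sum_comm]
    refine Finset.sum_congr rfl fun k _ => Finset.sum_congr rfl fun l _ => ?_
    rw [real_inner_comm (w l)]
    ring
  classical
  simp_rw [h]
  rw [Finset.sum_comm]
  refine Finset.sum_congr rfl fun k _ => ?_
  rw [Finset.sum_comm]
  simp_rw [← Finset.sum_mul, v.sum_inner_mul_inner, w.inner_eq_ite]
  simp

/-- The full first derivative of a space-time function. -/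
def d1 (u : Fn) (z : ℝ × E3) : ℝ × E3 →L[ℝ] ℝ := fderiv ℝ (fun p : ℝ × E3 => u p.1 p.2) z

/-- The full second derivative of a space-time function. -/
def d2 (u : Fn) (z : ℝ × E3) : ℝ × E3 →L[ℝ] ℝ × E3 →L[ℝ] ℝ := fderiv ℝ (d1 u) z

theorem Smooth.hasFDerivAt {u : Fn} (hu : Smooth u) (z : ℝ × E3) :
    HasFDerivAt (fun p : ℝ × E3 => u p.1 p.2) (d1 u z) z :=
  ((ContDiff.differentiable hu (by simp)) z).hasFDerivAt

theorem Smooth.contDiff_d1 {u : Fn} (hu : Smooth u) : ContDiff ℝ (⊤ : ℕ∞) (d1 u) :=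
  ContDiff.fderiv_right hu (by simp)

theorem Smooth.hasFDerivAt_d1 {u : Fn} (hu : Smooth u) (z : ℝ × E3) :
    HasFDerivAt (d1 u) (d2 u z) z :=
  ((hu.contDiff_d1.differentiable (by simp)) z).hasFDerivAt

theorem Smooth.continuous_d1 {u : Fn} (hu : Smooth u) : Continuous (d1 u) :=
  hu.contDiff_d1.continuous

theorem Smooth.continuous_d2 {u : Fn} (hu : Smooth u) : Continuous (d2 u) :=
  (ContDiff.fderiv_right (m := (⊤ : ℕ∞)) hu.contDiff_d1 (by simp)).continuous

theorem Smooth.d2_symm {u : Fn} (hu : Smooth u) (z v w : ℝ × E3) :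
    d2 u z v w = d2 u z w v := by
  have h : ContDiffAt ℝ (⊤ : ℕ∞) (fun p : ℝ × E3 => u p.1 p.2) z := ContDiff.contDiffAt hu
  exact h.isSymmSndFDerivAt (by
    rw [minSmoothness_of_isRCLikeNormedField]
    exact WithTop.coe_le_coe.2 (le_top : (2 : ℕ∞) ≤ ⊤)) v w

theorem Smooth.hasDerivAt_d1_apply {u : Fn} (hu : Smooth u) {γ v : ℝ → ℝ × E3}
    {γ' v' : ℝ × E3} {a : ℝ} (hγ : HasDerivAt γ γ' a) (hv : HasDerivAt v v' a) :
    HasDerivAt (fun s => d1 u (γ s) (v s)) (d2 u (γ a) γ' (v a) + d1 u (γ a) v') a :=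
  ((hu.hasFDerivAt_d1 (γ a)).comp_hasDerivAt a hγ).clm_apply hv

theorem Smooth.pt_eq {u : Fn} (hu : Smooth u) (t : ℝ) (x : E3) :
    pt u t x = d1 u (t, x) (1, 0) := by
  have h : HasDerivAt (fun s : ℝ => (s, x)) ((1 : ℝ), (0 : E3)) t :=
    (hasDerivAt_id t).prodMk (hasDerivAt_const t x)
  exact ((hu.hasFDerivAt (t, x)).comp_hasDerivAt t h).deriv

theorem Smooth.hasFDerivAt_slice {u : Fn} (hu : Smooth u) (t : ℝ) (x : E3) :
    HasFDerivAt (u t) ((d1 u (t, x)).comp (ContinuousLinearMap.inr ℝ ℝ E3)) x :=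
  (hu.hasFDerivAt (t, x)).comp x (hasFDerivAt_prodMk_right t x)

theorem Smooth.pd_eq {u : Fn} (hu : Smooth u) (j : Fin 3) (t : ℝ) (x : E3) :
    pd j u t x = d1 u (t, x) (0, EuclideanSpace.single j 1) := by
  rw [pd, (hu.hasFDerivAt_slice t x).fderiv]
  simp

theorem Smooth.directional {u : Fn} (hu : Smooth u) (v : ℝ × E3) :
    Smooth (fun t x => d1 u (t, x) v) :=
  hu.contDiff_d1.clm_apply contDiff_const

theorem Smooth.d1_directional {u : Fn} (hu : Smooth u) (v w z : ℝ × E3) :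
    d1 (fun t x => d1 u (t, x) v) z w = d2 u z w v := by
  have h := (hu.hasFDerivAt_d1 z).clm_apply (hasFDerivAt_const v z)
  have e : d1 (fun t x => d1 u (t, x) v) z = _ := h.fderiv
  rw [e]
  simp

theorem Smooth.pt_pt_eq {u : Fn} (hu : Smooth u) (t : ℝ) (x : E3) :
    pt (pt u) t x = d2 u (t, x) (1, 0) (1, 0) := by
  have e : pt u = fun t x => d1 u (t, x) (1, 0) := by ext t x; exact hu.pt_eq t x
  rw [e, (hu.directional _).pt_eq, hu.d1_directional]

theorem Smooth.pd_pd_eq {u : Fn} (hu : Smooth u) (j : Fin 3) (t : ℝ) (x : E3) :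
    pd j (pd j u) t x =
      d2 u (t, x) (0, EuclideanSpace.single j 1) (0, EuclideanSpace.single j 1) := by
  have e : pd j u = fun t x => d1 u (t, x) (0, EuclideanSpace.single j 1) := by
    ext t x; exact hu.pd_eq j t x
  rw [e, (hu.directional _).pd_eq, hu.d1_directional]

/-- The wave equation holds up to `t = 0`, with the Laplacian written in any orthonormal frame. -/
theorem IsFreeWaveSol.wave_eq {c : ℝ} {φ ψ : SFn} {u : Fn} (h : IsFreeWaveSol c φ ψ u)
    (b : OrthonormalBasis (Fin 3) ℝ E3) {t : ℝ} (ht : 0 ≤ t) (x : E3) :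
    d2 u (t, x) (1, 0) (1, 0) = c ^ 2 * ∑ j, d2 u (t, x) (0, b j) (0, b j) := by
  obtain ⟨hu, hw, -, -⟩ := h
  have hc := hu.continuous_d2
  have key : Set.EqOn (fun t : ℝ => d2 u (t, x) (1, 0) (1, 0))
      (fun t => c ^ 2 * ∑ j, d2 u (t, x) (0, b j) (0, b j)) (closure (Set.Ioi 0)) := by
    refine Set.EqOn.closure (fun s hs => ?_) (by fun_prop) (by fun_prop)
    have hs' := hw s x hs
    simp only [hu.pt_pt_eq, hu.pd_pd_eq] at hs'
    let T : E3 →ₗ[ℝ] E3 →ₗ[ℝ] ℝ := LinearMap.mk₂ ℝ (fun v w => d2 u (s, x) (0, v) (0, w))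
      (fun a b w => by rw [← add_apply, ← map_add]; simp)
      (fun r a w => by
        rw [← smul_apply, ← map_smul]; simp)
      (fun a v w => by rw [← map_add]; simp)
      (fun r a w => by rw [← map_smul]; simp)
    have e := sum_apply_orthonormalBasis T b (EuclideanSpace.basisFun (Fin 3) ℝ)
    simp only [T, LinearMap.mk₂_apply, EuclideanSpace.basisFun_apply] at e
    simp only [e]
    linarith
  rw [closure_Ioi] at key
  exact key ht

/-- The point of the unit sphere with polar angle `p` and azimuth `q` in the frame `b`. -/
def sph (b : OrthonormalBasis (Fin 3) ℝ E3) (p q : ℝ) : E3 :=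
  (Real.sin p * Real.cos q) • b 0 + (Real.sin p * Real.sin q) • b 1 + Real.cos p • b 2

/-- The unit tangent vector in the polar direction. -/
def sphPol (b : OrthonormalBasis (Fin 3) ℝ E3) (p q : ℝ) : E3 :=
  (Real.cos p * Real.cos q) • b 0 + (Real.cos p * Real.sin q) • b 1 + (-Real.sin p) • b 2

/-- The unit tangent vector in the azimuthal direction. -/
def sphAz (b : OrthonormalBasis (Fin 3) ℝ E3) (q : ℝ) : E3 :=
  (-Real.sin q) • b 0 + Real.cos q • b 1

theorem hasDerivAt_sph_pol (b : OrthonormalBasis (Fin 3) ℝ E3) (p q : ℝ) :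
    HasDerivAt (fun p => sph b p q) (sphPol b p q) p := by
  have h1 := (((Real.hasDerivAt_sin p).mul_const (Real.cos q)).smul_const (b 0)).add
    (((Real.hasDerivAt_sin p).mul_const (Real.sin q)).smul_const (b 1))
  exact h1.add ((Real.hasDerivAt_cos p).smul_const (b 2))

theorem hasDerivAt_sphPol (b : OrthonormalBasis (Fin 3) ℝ E3) (p q : ℝ) :
    HasDerivAt (fun p => sphPol b p q) (-sph b p q) p := by
  have h1 := (((Real.hasDerivAt_cos p).mul_const (Real.cos q)).smul_const (b 0)).add
    (((Real.hasDerivAt_cos p).mul_const (Real.sin q)).smul_const (b 1))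
  convert! h1.add ((Real.hasDerivAt_sin p).neg.smul_const (b 2)) using 1
  simp only [sph]
  module

theorem hasDerivAt_sph_az (b : OrthonormalBasis (Fin 3) ℝ E3) (p q : ℝ) :
    HasDerivAt (fun q => sph b p q) (Real.sin p • sphAz b q) q := by
  have h1 := (((Real.hasDerivAt_cos q).const_mul (Real.sin p)).smul_const (b 0)).add
    (((Real.hasDerivAt_sin q).const_mul (Real.sin p)).smul_const (b 1))
  convert! h1.add_const (Real.cos p • b 2) using 1
  simp only [sphAz]
  module

theorem hasDerivAt_sphAz (b : OrthonormalBasis (Fin 3) ℝ E3) (p q : ℝ) :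
    HasDerivAt (fun q => sphAz b q) (-(Real.sin p • sph b p q + Real.cos p • sphPol b p q)) q := by
  have h1 := ((Real.hasDerivAt_sin q).neg.smul_const (b 0)).add
    ((Real.hasDerivAt_cos q).smul_const (b 1))
  convert! h1 using 1
  simp only [sph, sphPol]
  have e := Real.sin_sq_add_cos_sq p
  have e' : Real.sin p ^ 2 = 1 - Real.cos p ^ 2 := by linarith
  match_scalars <;> ring_nf <;> simp only [e'] <;> ring

theorem continuous_sph_pol (b : OrthonormalBasis (Fin 3) ℝ E3) (q : ℝ) :
    Continuous fun p : ℝ => sph b p q :=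
  continuous_iff_continuousAt.2 fun p => (hasDerivAt_sph_pol b p q).continuousAt

@[fun_prop]
theorem continuous_sph (b : OrthonormalBasis (Fin 3) ℝ E3) :
    Continuous fun z : ℝ × ℝ => sph b z.1 z.2 := by
  unfold sph; fun_prop

@[fun_prop]
theorem continuous_sphPol (b : OrthonormalBasis (Fin 3) ℝ E3) :
    Continuous fun z : ℝ × ℝ => sphPol b z.1 z.2 := by
  unfold sphPol; fun_prop

@[fun_prop]
theorem continuous_sphAz (b : OrthonormalBasis (Fin 3) ℝ E3) :
    Continuous fun q : ℝ => sphAz b q := by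
  unfold sphAz; fun_prop

/-- The moving frame on the sphere computes the trace of a bilinear form. -/
theorem sum_apply_sph_frame (b : OrthonormalBasis (Fin 3) ℝ E3)
    (T : ℝ × E3 →L[ℝ] ℝ × E3 →L[ℝ] ℝ) (p q : ℝ) :
    ∑ j, T (0, b j) (0, b j) = T (0, sph b p q) (0, sph b p q)
      + T (0, sphPol b p q) (0, sphPol b p q) + T (0, sphAz b q) (0, sphAz b q) := by
  have e : ∀ r s t : ℝ, ((0 : ℝ), r • b 0 + s • b 1 + t • b 2) =
      r • ((0 : ℝ), b 0) + s • ((0 : ℝ), b 1) + t • ((0 : ℝ), b 2) := by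
    intro r s t; simp
  have e' : ∀ r s : ℝ, ((0 : ℝ), r • b 0 + s • b 1) =
      r • ((0 : ℝ), b 0) + s • ((0 : ℝ), b 1) := by
    intro r s; simp
  have hp := Real.sin_sq_add_cos_sq p
  have hq := Real.sin_sq_add_cos_sq q
  have hp' : Real.sin p ^ 2 = 1 - Real.cos p ^ 2 := by linarith
  have hq' : Real.sin q ^ 2 = 1 - Real.cos q ^ 2 := by linarith
  simp only [sph, sphPol, sphAz, e, e', map_add, map_smul, add_apply,
    smul_apply, smul_eq_mul, Fin.sum_univ_three]
  ring_nf
  simp only [hp', hq']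
  ring

/-- **Kirchhoff's formula**, in spherical coordinates about an arbitrary orthonormal frame. -/
theorem IsFreeWaveSol.kirchhoff {c : ℝ} {φ ψ : SFn} {u : Fn} (h : IsFreeWaveSol c φ ψ u)
    (b : OrthonormalBasis (Fin 3) ℝ E3) {t : ℝ} (ht : 0 ≤ t) (x : E3) :
    4 * Real.pi * u t x = ∫ q in 0..2 * Real.pi, ∫ p in 0..Real.pi, Real.sin p *
      (φ (x + (c * t) • sph b p q) + t * ψ (x + (c * t) • sph b p q) +
        c * t * fderiv ℝ φ (x + (c * t) • sph b p q) (sph b p q)) := by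
  have hu : Smooth u := h.1
  have hu0 : Continuous fun p : ℝ × E3 => u p.1 p.2 := ContDiff.continuous hu
  have hu1 := hu.continuous_d1
  have hu2 := hu.continuous_d2
  set z : ℝ → ℝ → ℝ → ℝ × E3 := fun s p q => (t - s, x + (c * s) • sph b p q) with hz
  have hzc : Continuous fun w : ℝ × ℝ × ℝ => z w.1 w.2.1 w.2.2 := by
    have := (continuous_sph b).comp (continuous_snd : Continuous fun w : ℝ × ℝ × ℝ => w.2)
    simp only [hz]
    exact (by fun_prop : Continuous fun w : ℝ × ℝ × ℝ => t - w.1).prodMk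
      (continuous_const.add ((by fun_prop : Continuous fun w : ℝ × ℝ × ℝ => c * w.1).smul this))
  have hzs : ∀ s p q, HasDerivAt (fun s => z s p q) ((-1 : ℝ), c • sph b p q) s := by
    intro s p q
    have h1 : HasDerivAt (fun s : ℝ => t - s) (-1) s := by
      simpa using (hasDerivAt_id s).const_sub t
    have h2 : HasDerivAt (fun s : ℝ => c * s) c s := by
      simpa using (hasDerivAt_id s).const_mul c
    exact h1.prodMk ((h2.smul_const (sph b p q)).const_add x)
  have hzp : ∀ s p q, HasDerivAt (fun p => z s p q) ((c * s) • ((0 : ℝ), sphPol b p q)) p := by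
    intro s p q
    have := (hasDerivAt_const p (t - s)).prodMk
      (((hasDerivAt_sph_pol b p q).const_smul (c * s)).const_add x)
    simpa using this
  have hzq : ∀ s p q, HasDerivAt (fun q => z s p q)
      ((c * s * Real.sin p) • ((0 : ℝ), sphAz b q)) q := by
    intro s p q
    have := (hasDerivAt_const q (t - s)).prodMk
      (((hasDerivAt_sph_az b p q).const_smul (c * s)).const_add x)
    simpa [smul_smul] using this
  have cω : Continuous fun w : ℝ × ℝ × ℝ => sph b w.2.1 w.2.2 :=
    (continuous_sph b).comp continuous_snd
  have cp : Continuous fun w : ℝ × ℝ × ℝ => sphPol b w.2.1 w.2.2 :=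
    (continuous_sphPol b).comp continuous_snd
  have ca : Continuous fun w : ℝ × ℝ × ℝ => sphAz b w.2.2 :=
    (continuous_sphAz b).comp (by fun_prop)
  have c0 := hu0.comp hzc
  have c1 := hu1.comp hzc
  have c2 := hu2.comp hzc
  simp only [Function.comp_def] at c0 c1 c2
  have key := integral_eq_of_divergence_free (T := t) (k := -c) ht
    (F := fun s p q => Real.sin p * (u (z s p q).1 (z s p q).2 +
      s * d1 u (z s p q) (1, c • sph b p q)))
    (F' := fun s p q => Real.sin p * (d1 u (z s p q) (-1, c • sph b p q) +
      (1 * d1 u (z s p q) (1, c • sph b p q) + s *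
        (d2 u (z s p q) (-1, c • sph b p q) (1, c • sph b p q) +
          d1 u (z s p q) 0))))
    (A := fun s p q => Real.sin p * d1 u (z s p q) (0, sphPol b p q))
    (A' := fun s p q => Real.cos p * d1 u (z s p q) (0, sphPol b p q) + Real.sin p *
      (d2 u (z s p q) ((c * s) • ((0 : ℝ), sphPol b p q)) (0, sphPol b p q) +
        d1 u (z s p q) (0, -sph b p q)))
    (B := fun s p q => d1 u (z s p q) (0, sphAz b q))
    (B' := fun s p q => d2 u (z s p q) ((c * s * Real.sin p) • ((0 : ℝ), sphAz b q))
        (0, sphAz b q) +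
      d1 u (z s p q) (0, -(Real.sin p • sph b p q + Real.cos p • sphPol b p q)))
    ?_ ?_ ?_ ?_ ?_ ?_ ?_ ?_ ?_ ?_
  · have e0 : ∀ p q, z 0 p q = (t, x) := by intro p q; simp [hz]
    have et : ∀ p q, z t p q = (0, x + (c * t) • sph b p q) := by intro p q; simp [hz]
    simp only [e0, et] at key
    have eu : ∀ p q, u 0 (x + (c * t) • sph b p q) + t *
        d1 u (0, x + (c * t) • sph b p q) (1, c • sph b p q) =
        φ (x + (c * t) • sph b p q) + t * ψ (x + (c * t) • sph b p q) +
        c * t * fderiv ℝ φ (x + (c * t) • sph b p q) (sph b p q) := by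
      intro p q
      have hφ : φ = u 0 := by ext y; exact (h.2.2.1 y).symm
      have e1 : ((1 : ℝ), c • sph b p q) = ((1 : ℝ), (0 : E3)) + c • ((0 : ℝ), sph b p q) := by
        simp
      rw [← h.2.2.2, hu.pt_eq, hφ, (hu.hasFDerivAt_slice 0 _).fderiv, e1, map_add, map_smul]
      simp only [ContinuousLinearMap.comp_apply, ContinuousLinearMap.inr_apply, smul_eq_mul]
      ring
    simp only [eu] at key
    rw [key]
    simp
    ring
  · intro s p q
    have h1 := (hu.hasFDerivAt (z s p q)).comp_hasDerivAt s (hzs s p q)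
    have h2 := hu.hasDerivAt_d1_apply (hzs s p q)
      (hasDerivAt_const s ((1 : ℝ), c • sph b p q))
    exact (h1.add ((hasDerivAt_id s).mul h2)).const_mul (Real.sin p)
  · intro s p q
    have h1 := hu.hasDerivAt_d1_apply (hzp s p q)
      ((hasDerivAt_const p (0 : ℝ)).prodMk (hasDerivAt_sphPol b p q))
    exact (Real.hasDerivAt_sin p).mul h1
  · intro s p q
    exact hu.hasDerivAt_d1_apply (hzq s p q)
      ((hasDerivAt_const q (0 : ℝ)).prodMk (hasDerivAt_sphAz b p q))
  · fun_prop
  · fun_prop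
  · fun_prop
  · fun_prop
  · intro s hs p q
    have hw := h.wave_eq b (sub_nonneg.2 hs.2) (x + (c * s) • sph b p q)
    rw [sum_apply_sph_frame b _ p q] at hw
    have hsym := hu.d2_symm (z s p q) (0, sph b p q) (1, 0)
    have e1 : ((1 : ℝ), c • sph b p q) = ((1 : ℝ), (0 : E3)) + c • ((0 : ℝ), sph b p q) := by
      simp
    have e2 : ((-1 : ℝ), c • sph b p q) = -((1 : ℝ), (0 : E3)) + c • ((0 : ℝ), sph b p q) := by
      simp
    have e3 : ((0 : ℝ), -sph b p q) = -((0 : ℝ), sph b p q) := by simp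
    have e4 : ((0 : ℝ), -(Real.sin p • sph b p q + Real.cos p • sphPol b p q)) =
        -(Real.sin p • ((0 : ℝ), sph b p q) + Real.cos p • ((0 : ℝ), sphPol b p q)) := by
      simp
    rw [e1, e2, e3, e4]
    simp only [map_add, map_neg, map_smul, add_apply, smul_apply, neg_apply, smul_eq_mul,
      map_zero, hsym]
    simp only [hz] at hw ⊢
    rw [hw]
    ring
  · intro s q; simp
  · intro s p; simp [hz, sph, sphAz]

theorem jb_le (a : ℝ) : jb a ≤ 1 + |a| := by
  rw [jb, Real.sqrt_le_left (by positivity), ← sq_abs a]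
  nlinarith [abs_nonneg a]

theorem le_two_mul_jb (a : ℝ) : 1 + |a| ≤ 2 * jb a := by
  have h1 : 1 ≤ jb a := Real.one_le_sqrt.2 (by nlinarith [sq_nonneg a])
  have h2 : |a| ≤ jb a := Real.abs_le_sqrt (by linarith)
  linarith

theorem jb_pos (a : ℝ) : 0 < jb a := Real.sqrt_pos.2 (by positivity)

theorem contDiff_sd {φ : SFn} (hφ : ContDiff ℝ (⊤ : ℕ∞) φ) (j : Fin 3) :
    ContDiff ℝ (⊤ : ℕ∞) (sd j φ) :=
  (hφ.fderiv_right (m := (⊤ : ℕ∞)) (by simp)).clm_apply contDiff_const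

theorem contDiff_srot {φ : SFn} (hφ : ContDiff ℝ (⊤ : ℕ∞) φ) (j k : Fin 3) :
    ContDiff ℝ (⊤ : ℕ∞) (srot j k φ) := by
  have h1 := contDiff_sd hφ j
  have h2 := contDiff_sd hφ k
  exact ((EuclideanSpace.proj j : E3 →L[ℝ] ℝ).contDiff.mul h2).sub
    ((EuclideanSpace.proj k : E3 →L[ℝ] ℝ).contDiff.mul h1)

theorem contDiff_Sop {φ : SFn} (hφ : ContDiff ℝ (⊤ : ℕ∞) φ) (i : Fin 6) :
    ContDiff ℝ (⊤ : ℕ∞) (Sop i φ) := by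
  fin_cases i
  · exact contDiff_sd hφ 0
  · exact contDiff_sd hφ 1
  · exact contDiff_sd hφ 2
  · exact contDiff_srot hφ 0 1
  · exact contDiff_srot hφ 0 2
  · exact contDiff_srot hφ 1 2

theorem contDiff_Sop_iterate {φ : SFn} (hφ : ContDiff ℝ (⊤ : ℕ∞) φ) (i : Fin 6) (n : ℕ) :
    ContDiff ℝ (⊤ : ℕ∞) ((Sop i)^[n] φ) := by
  induction n with
  | zero => exact hφ
  | succ n ih => rw [Function.iterate_succ_apply']; exact contDiff_Sop ih i

theorem contDiff_Spow {φ : SFn} (hφ : ContDiff ℝ (⊤ : ℕ∞) φ) (α : Fin 6 → ℕ) :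
    ContDiff ℝ (⊤ : ℕ∞) (Spow α φ) := by
  unfold Spow
  iterate 6 refine contDiff_Sop_iterate ?_ _ _
  exact hφ

theorem continuous_snorm {φ : SFn} (hφ : ContDiff ℝ (⊤ : ℕ∞) φ) (s : ℕ) :
    Continuous (snorm s φ) :=
  continuous_finsetSum _ fun α _ => (contDiff_Spow hφ α).continuous.abs

theorem snorm_nonneg (s : ℕ) (φ : SFn) (x : E3) : 0 ≤ snorm s φ x :=
  Finset.sum_nonneg fun _ _ => abs_nonneg _

theorem abs_add_sum_abs_sd_le_snorm (φ : SFn) (x : E3) :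
    |φ x| + (|sd 0 φ x| + |sd 1 φ x| + |sd 2 φ x|) ≤ snorm 1 φ x := by
  have hsub : ({![0, 0, 0, 0, 0, 0], ![1, 0, 0, 0, 0, 0], ![0, 1, 0, 0, 0, 0],
      ![0, 0, 1, 0, 0, 0]} : Finset (Fin 6 → ℕ)) ⊆ smultiIdx 1 := by
    intro α hα
    simp only [Finset.mem_insert, Finset.mem_singleton] at hα
    simp only [smultiIdx, Finset.mem_filter, Fintype.mem_piFinset, Finset.mem_range]
    rcases hα with rfl | rfl | rfl | rfl <;> decide
  refine le_trans (le_of_eq ?_)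
    (Finset.sum_le_sum_of_subset_of_nonneg hsub fun _ _ _ => abs_nonneg _)
  rw [Finset.sum_insert (by decide), Finset.sum_insert (by decide),
    Finset.sum_insert (by decide), Finset.sum_singleton]
  simp [Spow, Sop, add_assoc]

theorem abs_le_snorm (φ : SFn) (x : E3) : |φ x| ≤ snorm 1 φ x := by
  have := abs_add_sum_abs_sd_le_snorm φ x
  have h0 := abs_nonneg (sd 0 φ x)
  have h1 := abs_nonneg (sd 1 φ x)
  have h2 := abs_nonneg (sd 2 φ x)
  linarith

theorem abs_fderiv_le_snorm (φ : SFn) (x : E3) {v : E3} (hv : ‖v‖ ≤ 1) :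
    |fderiv ℝ φ x v| ≤ snorm 1 φ x := by
  have e : fderiv ℝ φ x v = ∑ j, v j * sd j φ x := by
    conv_lhs => rw [← (EuclideanSpace.basisFun (Fin 3) ℝ).sum_repr v]
    simp [sd]
  have hj : ∀ j, |v j * sd j φ x| ≤ |sd j φ x| := by
    intro j
    rw [abs_mul]
    have : |v j| ≤ 1 := (PiLp.norm_apply_le v j).trans hv
    exact mul_le_of_le_one_left (abs_nonneg _) this
  have h := abs_add_sum_abs_sd_le_snorm φ x
  have h0 := abs_nonneg (φ x)
  rw [e]
  refine (Finset.abs_sum_le_sum_abs _ _).trans ((Finset.sum_le_sum fun j _ => hj j).trans ?_)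
  rw [Fin.sum_univ_three]
  linarith

/-- The set defining the weighted supremum of the data is bounded. -/
theorem bddAbove_weighted_data {φ ψ : SFn} (hφ : ContDiff ℝ (⊤ : ℕ∞) φ)
    (hψ : ContDiff ℝ (⊤ : ℕ∞) ψ) (κ R : ℝ) (x : E3) :
    BddAbove {b : ℝ | ∃ y : E3, ‖y - x‖ ≤ R ∧
      b = jb ‖y‖ ^ κ * (jb ‖y‖ * snorm 1 φ y + ‖y‖ * |ψ y|)} := by
  have hN := continuous_snorm hφ 1
  have hψ' := hψ.continuous
  have hjb : Continuous fun y : E3 => jb ‖y‖ := by unfold jb; fun_prop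
  have hc : Continuous fun y : E3 => jb ‖y‖ ^ κ * (jb ‖y‖ * snorm 1 φ y + ‖y‖ * |ψ y|) :=
    (hjb.rpow_const fun y => Or.inl (jb_pos _).ne').mul
      ((hjb.mul hN).add (continuous_norm.mul hψ'.abs))
  refine ((isCompact_closedBall x R).bddAbove_image hc.continuousOn).mono ?_
  rintro _ ⟨y, hy, rfl⟩
  exact ⟨y, by rwa [Metric.mem_closedBall, dist_eq_norm], rfl⟩

theorem norm_sph (b : OrthonormalBasis (Fin 3) ℝ E3) (p q : ℝ) : ‖sph b p q‖ = 1 := by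
  have h : ‖sph b p q‖ ^ 2 = 1 := by
    have ho := orthonormal_iff_ite.1 b.orthonormal
    rw [← real_inner_self_eq_norm_sq]
    simp only [sph, inner_add_left, inner_add_right, real_inner_smul_left,
      real_inner_smul_right, ho]
    have hp := Real.sin_sq_add_cos_sq p
    have hq := Real.sin_sq_add_cos_sq q
    have hq' : Real.sin q ^ 2 = 1 - Real.cos q ^ 2 := by linarith
    simp
    ring_nf
    rw [hq']
    linarith
  nlinarith [norm_nonneg (sph b p q)]

theorem norm_smul_add_smul_sph (b : OrthonormalBasis (Fin 3) ℝ E3) (r τ p q : ℝ) :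
    ‖r • b 2 + τ • sph b p q‖ = Real.sqrt (r ^ 2 + 2 * r * τ * Real.cos p + τ ^ 2) := by
  have ho := orthonormal_iff_ite.1 b.orthonormal
  have h2 : inner ℝ (b 2) (sph b p q) = Real.cos p := by
    simp only [sph, inner_add_right, real_inner_smul_right, ho]
    simp
  rw [← Real.sqrt_sq (norm_nonneg _), norm_add_sq_real, real_inner_smul_left,
    real_inner_smul_right, h2, norm_smul, norm_smul, norm_sph, b.norm_eq_one]
  congr 1
  rw [mul_one, mul_one, Real.norm_eq_abs, Real.norm_eq_abs, sq_abs, sq_abs]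
  ring

/-- Every vector is a nonnegative multiple of the last vector of some orthonormal frame. -/
theorem exists_frame (x : E3) :
    ∃ b : OrthonormalBasis (Fin 3) ℝ E3, x = ‖x‖ • b 2 := by
  rcases eq_or_ne x 0 with rfl | hx
  · exact ⟨EuclideanSpace.basisFun (Fin 3) ℝ, by simp⟩
  · have hv : Orthonormal ℝ (({2} : Set (Fin 3)).domRestrict
        (fun _ : Fin 3 => (‖x‖⁻¹ : ℝ) • x)) := by
      constructor
      · intro i
        simp [norm_smul, hx]
      · rintro ⟨i, hi⟩ ⟨j, hj⟩ hij
        simp only [Set.mem_singleton_iff] at hi hj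
        subst hi hj
        exact absurd rfl hij
    obtain ⟨b, hb⟩ := hv.exists_orthonormalBasis_extension_of_card_eq (by simp)
    refine ⟨b, ?_⟩
    rw [hb 2 rfl, smul_smul, mul_inv_cancel₀ (norm_ne_zero_iff.2 hx), one_smul]

/-- A primitive of `ρ ↦ (1 + ρ) ^ (-κ)`. -/
def decayPrim (κ ρ : ℝ) : ℝ := -((1 + ρ) ^ (1 - κ) / (κ - 1))

theorem hasDerivAt_decayPrim {κ ρ : ℝ} (hκ : 1 < κ) (hρ : -1 < ρ) :
    HasDerivAt (decayPrim κ) ((1 + ρ) ^ (-κ)) ρ := by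
  have h1 : HasDerivAt (fun ρ : ℝ => 1 + ρ) 1 ρ := (hasDerivAt_id ρ).const_add 1
  have h2 := ((h1.rpow_const (p := 1 - κ) (Or.inl (by linarith))).div_const (κ - 1)).neg
  convert! h2 using 1
  have : κ - 1 ≠ 0 := by linarith
  rw [show 1 - κ - 1 = -κ by ring]
  field_simp
  ring

theorem decayPrim_sub_le {κ r τ : ℝ} (hκ : 1 < κ) (hr : 0 < r) (hτ : 0 ≤ τ) :
    (decayPrim κ (r + τ) - decayPrim κ |r - τ|) / r ≤
      (2 + 1 / (κ - 1)) * ((1 + |r - τ|) ^ (1 - κ) / (1 + r)) := by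
  set a := |r - τ| with ha
  have ha0 : 0 ≤ a := abs_nonneg _
  have hab : a ≤ r + τ := abs_le.2 ⟨by linarith, by linarith⟩
  have hba : r + τ - a ≤ 2 * r := by
    have := neg_abs_le (r - τ); linarith
  set P := (1 + a) ^ (1 - κ) with hP
  have hP0 : 0 < P := by positivity
  have hκ' : 0 < κ - 1 := by linarith
  have hmv : decayPrim κ (r + τ) - decayPrim κ a ≤ P * (2 * r) := by
    have hd : ∀ ρ ∈ Set.Icc a (r + τ), HasDerivAt (decayPrim κ) ((1 + ρ) ^ (-κ)) ρ :=
      fun ρ hρ => hasDerivAt_decayPrim hκ (by linarith [hρ.1])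
    have := (convex_Icc a (r + τ)).image_sub_le_mul_sub_of_deriv_le (f := decayPrim κ) (C := P)
      (fun ρ hρ => (hd ρ hρ).continuousAt.continuousWithinAt)
      (fun ρ hρ => (hd ρ (interior_subset hρ)).differentiableAt.differentiableWithinAt)
      (fun ρ hρ => ?_) a (Set.left_mem_Icc.2 hab) (r + τ) (Set.right_mem_Icc.2 hab) hab
    · exact this.trans (mul_le_mul_of_nonneg_left hba hP0.le)
    · have hρ' := interior_subset hρ
      rw [(hd ρ hρ').deriv]
      calc (1 + ρ) ^ (-κ) ≤ (1 + a) ^ (-κ) :=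
            Real.rpow_le_rpow_of_nonpos (by linarith) (by linarith [hρ'.1]) (by linarith)
        _ ≤ P := Real.rpow_le_rpow_of_exponent_le (by linarith) (by linarith)
  have hinf : decayPrim κ (r + τ) - decayPrim κ a ≤ P / (κ - 1) := by
    have : 0 ≤ (1 + (r + τ)) ^ (1 - κ) / (κ - 1) := by positivity
    simp only [decayPrim]
    linarith
  rw [div_le_iff₀ hr, mul_div_assoc', div_mul_eq_mul_div, le_div_iff₀ (by linarith)]
  calc (decayPrim κ (r + τ) - decayPrim κ a) * (1 + r)
      = (decayPrim κ (r + τ) - decayPrim κ a) + (decayPrim κ (r + τ) - decayPrim κ a) * r := by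
        ring
    _ ≤ P * (2 * r) + P / (κ - 1) * r :=
        add_le_add hmv (mul_le_mul_of_nonneg_right hinf hr.le)
    _ = (2 + 1 / (κ - 1)) * P * r := by ring

/-- Integration over the polar angle of a function dominated by a weight in the distance
`√(r² + 2rτ cos p + τ²)` to the origin. -/
theorem integral_sin_mul_le {κ r τ Q D : ℝ} (hκ : 1 < κ) (hr : 0 < r) (hτ : 0 ≤ τ)
    {f : ℝ → ℝ} (hf : Continuous f)
    (hfle : ∀ p ∈ Set.Ioo 0 Real.pi,
      f p ≤ Q * τ * ((1 + Real.sqrt (r ^ 2 + 2 * r * τ * Real.cos p + τ ^ 2)) ^ (-κ) /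
        Real.sqrt (r ^ 2 + 2 * r * τ * Real.cos p + τ ^ 2)) + D) :
    ∫ p in 0..Real.pi, Real.sin p * f p ≤
      Q * ((decayPrim κ (r + τ) - decayPrim κ |r - τ|) / r) + 2 * D := by
  set ρ : ℝ → ℝ := fun p => Real.sqrt (r ^ 2 + 2 * r * τ * Real.cos p + τ ^ 2) with hρ
  have hρc : Continuous ρ := by simp only [hρ]; fun_prop
  have hρ0 : ∀ p, 0 ≤ ρ p := fun p => Real.sqrt_nonneg _
  have hpos : ∀ p ∈ Set.Ioo 0 Real.pi, 0 < r ^ 2 + 2 * r * τ * Real.cos p + τ ^ 2 := by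
    intro p hp
    have hs := Real.sin_pos_of_pos_of_lt_pi hp.1 hp.2
    have hsc := Real.sin_sq_add_cos_sq p
    have : r ^ 2 + 2 * r * τ * Real.cos p + τ ^ 2 =
        (τ + r * Real.cos p) ^ 2 + (r * Real.sin p) ^ 2 := by
      linear_combination (-r ^ 2) * hsc
    rw [this]
    positivity
  have hcont : Continuous fun p => -(Q / r) * decayPrim κ (ρ p) - D * Real.cos p := by
    unfold decayPrim
    have : Continuous fun p => (1 + ρ p) ^ (1 - κ) :=
      (continuous_const.add hρc).rpow_const fun p =>
        Or.inl (add_pos_of_pos_of_nonneg one_pos (hρ0 p)).ne'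
    fun_prop
  have key := intervalIntegral.integral_le_sub_of_hasDeriv_right_of_le Real.pi_pos.le
    (φ := fun p => Real.sin p * f p)
    (g' := fun p => Real.sin p * (Q * τ * ((1 + ρ p) ^ (-κ) / ρ p) + D))
    hcont.continuousOn ?_ ?_ ?_
  · refine key.trans (le_of_eq ?_)
    have e0 : ρ 0 = r + τ := by
      simp only [hρ, Real.cos_zero]
      rw [show r ^ 2 + 2 * r * τ * 1 + τ ^ 2 = (r + τ) ^ 2 by ring, Real.sqrt_sq (by linarith)]
    have eπ : ρ Real.pi = |r - τ| := by
      simp only [hρ, Real.cos_pi]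
      rw [show r ^ 2 + 2 * r * τ * -1 + τ ^ 2 = (r - τ) ^ 2 by ring, Real.sqrt_sq_eq_abs]
    simp only [e0, eπ, Real.cos_zero, Real.cos_pi]
    ring
  · intro p hp
    have hq := hpos p hp
    have hρp : 0 < ρ p := Real.sqrt_pos.2 hq
    have h1 : HasDerivAt (fun p => r ^ 2 + 2 * r * τ * Real.cos p + τ ^ 2)
        (2 * r * τ * -Real.sin p) p :=
      (((Real.hasDerivAt_cos p).const_mul (2 * r * τ)).const_add (r ^ 2)).add_const (τ ^ 2)
    have h2 : HasDerivAt ρ (2 * r * τ * -Real.sin p / (2 * ρ p)) p := h1.sqrt hq.ne'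
    have h3 := (((hasDerivAt_decayPrim hκ (by linarith : -1 < ρ p)).comp p h2).const_mul
      (-(Q / r))).sub ((Real.hasDerivAt_cos p).const_mul D)
    convert! h3.hasDerivWithinAt using 1
    field_simp
    ring
  · exact (Real.continuous_sin.mul hf).continuousOn.integrableOn_Icc
  · intro p hp
    exact mul_le_mul_of_nonneg_left (hfle p hp)
      (Real.sin_pos_of_pos_of_lt_pi hp.1 hp.2).le

/-- A uniform bound for the polar integrals in Kirchhoff's formula bounds the solution. -/
theorem IsFreeWaveSol.abs_le {c : ℝ} {φ ψ : SFn} {u : Fn} (h : IsFreeWaveSol c φ ψ u)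
    (hφ : ContDiff ℝ (⊤ : ℕ∞) φ) (hψ : Continuous ψ)
    (b : OrthonormalBasis (Fin 3) ℝ E3) {t : ℝ} (ht : 0 ≤ t) (x : E3) {L : ℝ}
    (hL : ∀ f : ℝ → ℝ, Continuous f → ∀ q, (∀ p, |f p| ≤ t * |ψ (x + (c * t) • sph b p q)| +
      (1 + |c * t|) * snorm 1 φ (x + (c * t) • sph b p q)) →
      ∫ p in 0..Real.pi, Real.sin p * f p ≤ 2 * L) :
    |u t x| ≤ L := by
  set K : ℝ → ℝ → ℝ := fun q p => φ (x + (c * t) • sph b p q) +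
    t * ψ (x + (c * t) • sph b p q) +
    c * t * fderiv ℝ φ (x + (c * t) • sph b p q) (sph b p q) with hK
  have hKc : ∀ q, Continuous (K q) := by
    intro q
    have h1 := continuous_sph_pol b q
    have h2 : Continuous fun p => x + (c * t) • sph b p q :=
      continuous_const.add (h1.const_smul (c * t))
    have h3 : Continuous (fderiv ℝ φ) := hφ.continuous_fderiv (by simp)
    have c1 : Continuous fun p => φ (x + (c * t) • sph b p q) := hφ.continuous.comp h2
    have c2 : Continuous fun p => ψ (x + (c * t) • sph b p q) := hψ.comp h2
    have c3 : Continuous fun p => fderiv ℝ φ (x + (c * t) • sph b p q) := h3.comp h2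
    have c4 := c3.clm_apply h1
    exact (c1.add (c2.const_mul t)).add (c4.const_mul (c * t))
  have hKle : ∀ q p, |K q p| ≤ t * |ψ (x + (c * t) • sph b p q)| +
      (1 + |c * t|) * snorm 1 φ (x + (c * t) • sph b p q) := by
    intro q p
    set y := x + (c * t) • sph b p q
    have h1 := abs_le_snorm φ y
    have h2 := abs_fderiv_le_snorm φ y (norm_sph b p q).le
    have h3 : |K q p| ≤ |φ y| + |t * ψ y| + |c * t * fderiv ℝ φ y (sph b p q)| :=
      abs_add_three _ _ _
    rw [abs_mul t, abs_of_nonneg ht, abs_mul (c * t)] at h3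
    have h4 := mul_le_mul_of_nonneg_left h2 (abs_nonneg (c * t))
    linarith
  have hin : ∀ q, ‖∫ p in 0..Real.pi, Real.sin p * K q p‖ ≤ 2 * L := by
    intro q
    rw [Real.norm_eq_abs, abs_le']
    refine ⟨hL _ (hKc q) q (hKle q), ?_⟩
    have := hL (fun p => -K q p) (hKc q).neg q (fun p => by rw [abs_neg]; exact hKle q p)
    simpa [← intervalIntegral.integral_neg] using this
  have hout := intervalIntegral.norm_integral_le_of_norm_le_const (a := 0) (b := 2 * Real.pi)
    (fun q _ => hin q)
  rw [← h.kirchhoff b ht x] at hout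
  have hpi := Real.pi_pos
  rw [Real.norm_eq_abs, abs_mul, sub_zero, abs_of_pos (by positivity : 0 < 4 * Real.pi),
    abs_of_pos (by positivity : 0 < 2 * Real.pi)] at hout
  have : 4 * Real.pi * |u t x| ≤ 4 * Real.pi * L := by linarith
  exact le_of_mul_le_mul_left this (by positivity)

/-- The decay estimate inside the forward light cone, away from its boundary. -/
theorem IsFreeWaveSol.decay_of_le {c κ : ℝ} {φ ψ : SFn} {u : Fn} (h : IsFreeWaveSol c φ ψ u)
    (hc : 0 < c) (hκ : 1 < κ) (hφ : ContDiff ℝ (⊤ : ℕ∞) φ) (hψ : Continuous ψ) {t M : ℝ}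
    (ht : 0 ≤ t) (hM0 : 0 ≤ M) (x : E3)
    (hM : ∀ y : E3, ‖y - x‖ ≤ c * t →
      (1 + ‖y‖) * snorm 1 φ y + ‖y‖ * |ψ y| ≤ M * (1 + ‖y‖) ^ (-κ))
    (hx : 2 * ‖x‖ ≤ c * t) :
    (1 + t + ‖x‖) * ((1 + |‖x‖ - c * t|) ^ (κ - 1) * |u t x|) ≤
      (2 / c + 1) * (2 / c + 2) * M := by
  obtain ⟨b, hb⟩ := exists_frame x
  set τ := c * t with hτ
  have hτ0 : 0 ≤ τ := by positivity
  have htτ : t = 1 / c * τ := by rw [hτ]; field_simp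
  set a := |‖x‖ - τ| with ha
  have ha' : a = τ - ‖x‖ := by
    rw [ha, abs_sub_comm, abs_of_nonneg]; linarith [norm_nonneg x]
  have ha0 : 0 ≤ a := abs_nonneg _
  have haτ : τ ≤ 2 * a := by linarith
  have hic : 0 < 1 / c := by positivity
  have hu : |u t x| ≤ (2 / c + 2) * M * (1 + a) ^ (-κ) := by
    refine h.abs_le hφ hψ b ht x fun f hf q hfle => ?_
    have := integral_sin_mul_le (r := 1) (τ := 0) (Q := 0)
      (D := (2 / c + 2) * M * (1 + a) ^ (-κ)) hκ one_pos le_rfl hf ?_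
    · simpa using this
    intro p _
    refine (le_abs_self _).trans ((hfle p).trans ?_)
    rw [zero_mul, zero_mul, zero_add]
    set y := x + (c * t) • sph b p q with hy
    have hyx : ‖y - x‖ = τ := by
      simp [hy, norm_smul, norm_sph, ← hτ, abs_of_nonneg hτ0]
    have hya : a ≤ ‖y‖ := by
      have := norm_sub_le y x
      linarith
    have hyM := hM y hyx.le
    have hN := snorm_nonneg 1 φ y
    have hP := abs_nonneg (ψ y)
    have hy0 := norm_nonneg y
    rw [← hτ, abs_of_nonneg hτ0]
    have h1 : t * |ψ y| ≤ 2 / c * (‖y‖ * |ψ y|) := by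
      have : t ≤ 2 / c * ‖y‖ := by
        rw [htτ, show 2 / c * ‖y‖ = 1 / c * (2 * ‖y‖) by ring]
        exact mul_le_mul_of_nonneg_left (by linarith) hic.le
      calc t * |ψ y| ≤ 2 / c * ‖y‖ * |ψ y| := mul_le_mul_of_nonneg_right this hP
        _ = _ := by ring
    have h2 : (1 + τ) * snorm 1 φ y ≤ 2 * ((1 + ‖y‖) * snorm 1 φ y) := by
      rw [← mul_assoc]
      exact mul_le_mul_of_nonneg_right (by linarith) hN
    have h3 : (1 + ‖y‖) ^ (-κ) ≤ (1 + a) ^ (-κ) :=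
      Real.rpow_le_rpow_of_nonpos (by linarith) (by linarith) (by linarith)
    calc t * |ψ y| + (1 + τ) * snorm 1 φ y
        ≤ 2 / c * (‖y‖ * |ψ y|) + 2 * ((1 + ‖y‖) * snorm 1 φ y) := add_le_add h1 h2
      _ ≤ (2 / c + 2) * ((1 + ‖y‖) * snorm 1 φ y + ‖y‖ * |ψ y|) := by
          have : 0 ≤ 2 / c * ((1 + ‖y‖) * snorm 1 φ y) + 2 * (‖y‖ * |ψ y|) := by positivity
          linarith
      _ ≤ (2 / c + 2) * (M * (1 + a) ^ (-κ)) := by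
          refine mul_le_mul_of_nonneg_left (hyM.trans ?_) (by positivity)
          exact mul_le_mul_of_nonneg_left h3 hM0
      _ = _ := by ring
  have hw : 1 + t + ‖x‖ ≤ (2 / c + 1) * (1 + a) := by
    have h1 : t ≤ 1 / c * (2 * a) := by
      rw [htτ]; exact mul_le_mul_of_nonneg_left haτ hic.le
    have h2 : ‖x‖ ≤ a := by linarith
    have : 0 ≤ 2 / c := by positivity
    calc 1 + t + ‖x‖ ≤ 1 + 1 / c * (2 * a) + a := by linarith
      _ ≤ (2 / c + 1) * (1 + a) := by ring_nf; ring_nf at this; linarith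
  calc (1 + t + ‖x‖) * ((1 + a) ^ (κ - 1) * |u t x|)
      ≤ ((2 / c + 1) * (1 + a)) *
        ((1 + a) ^ (κ - 1) * ((2 / c + 2) * M * (1 + a) ^ (-κ))) := by gcongr
    _ = (2 / c + 1) * (2 / c + 2) * M *
        ((1 + a) ^ (1 : ℝ) * (1 + a) ^ (κ - 1) * (1 + a) ^ (-κ)) := by
        rw [Real.rpow_one]; ring
    _ = (2 / c + 1) * (2 / c + 2) * M := by
        rw [← Real.rpow_add (by linarith), ← Real.rpow_add (by linarith)]
        simp

/-- The decay estimate near and outside the forward light cone. -/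
theorem IsFreeWaveSol.decay_of_ge {c κ : ℝ} {φ ψ : SFn} {u : Fn} (h : IsFreeWaveSol c φ ψ u)
    (hc : 0 < c) (hκ : 1 < κ) (hφ : ContDiff ℝ (⊤ : ℕ∞) φ) (hψ : Continuous ψ) {t M : ℝ}
    (ht : 0 ≤ t) (hM0 : 0 ≤ M) (x : E3)
    (hM : ∀ y : E3, ‖y - x‖ ≤ c * t →
      (1 + ‖y‖) * snorm 1 φ y + ‖y‖ * |ψ y| ≤ M * (1 + ‖y‖) ^ (-κ))
    (hx : c * t < 2 * ‖x‖) :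
    (1 + t + ‖x‖) * ((1 + |‖x‖ - c * t|) ^ (κ - 1) * |u t x|) ≤
      (2 / c + 1) * ((1 / c + 2) * (2 + 1 / (κ - 1)) + 8) * M := by
  obtain ⟨b, hb⟩ := exists_frame x
  set τ := c * t with hτ
  set r := ‖x‖ with hr
  have hτ0 : 0 ≤ τ := by positivity
  have hr0 : 0 < r := by linarith
  have htτ : t = 1 / c * τ := by rw [hτ]; field_simp
  set a := |r - τ| with ha
  have ha0 : 0 ≤ a := abs_nonneg _
  have hic : 0 < 1 / c := by positivity
  have hκ' : 0 < κ - 1 := by linarith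
  set W := (1 + a) ^ (1 - κ) / (1 + r) with hW
  have hW0 : 0 < W := by positivity
  have hu : |u t x| ≤ ((1 / c + 2) * (2 + 1 / (κ - 1)) + 8) * M * W := by
    refine h.abs_le hφ hψ b ht x fun f hf q hfle => ?_
    have := integral_sin_mul_le (r := r) (τ := τ) (Q := (1 / c + 2) * M) (D := 4 * M * W)
      hκ hr0 hτ0 hf ?_
    · refine this.trans ?_
      have h1 := mul_le_mul_of_nonneg_left (decayPrim_sub_le hκ hr0 hτ0)
        (by positivity : 0 ≤ (1 / c + 2) * M)
      have h2 : 0 ≤ (1 / c + 2) * (2 + 1 / (κ - 1)) * M * W + 8 * M * W := by positivity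
      linarith
    intro p hp
    refine (le_abs_self _).trans ((hfle p).trans ?_)
    set y := x + (c * t) • sph b p q with hy
    have hyx : ‖y - x‖ = τ := by
      simp [hy, norm_smul, norm_sph, ← hτ, abs_of_nonneg hτ0]
    have hyr : Real.sqrt (r ^ 2 + 2 * r * τ * Real.cos p + τ ^ 2) = ‖y‖ := by
      rw [← norm_smul_add_smul_sph b r τ p q, ← hb]
    have hya : a ≤ ‖y‖ := by
      have h1 := abs_norm_sub_norm_le x (x - y)
      rwa [sub_sub_cancel, norm_sub_rev x y, hyx] at h1
    have hyM := hM y hyx.le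
    have hN := snorm_nonneg 1 φ y
    have hP := abs_nonneg (ψ y)
    have hs := Real.sin_pos_of_pos_of_lt_pi hp.1 hp.2
    have hy0 : 0 < ‖y‖ := by
      rw [← hyr]
      apply Real.sqrt_pos.2
      have hsc := Real.sin_sq_add_cos_sq p
      have : r ^ 2 + 2 * r * τ * Real.cos p + τ ^ 2 =
          (τ + r * Real.cos p) ^ 2 + (r * Real.sin p) ^ 2 := by
        linear_combination (-r ^ 2) * hsc
      rw [this]
      positivity
    rw [← hτ, abs_of_nonneg hτ0, hyr]
    set V := (1 + ‖y‖) ^ (-κ) with hV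
    have hV0 : 0 < V := by positivity
    have h1 : snorm 1 φ y + |ψ y| ≤ M * (V / ‖y‖) := by
      rw [← mul_div_assoc, le_div_iff₀ hy0]
      linarith
    have h2 : t * |ψ y| + 2 * τ * snorm 1 φ y ≤ (1 / c + 2) * M * τ * (V / ‖y‖) := by
      calc t * |ψ y| + 2 * τ * snorm 1 φ y
          ≤ (1 / c + 2) * τ * (snorm 1 φ y + |ψ y|) := by
            have : 0 ≤ 1 / c * τ * snorm 1 φ y + 2 * τ * |ψ y| := by positivity
            rw [htτ]
            linarith
        _ ≤ (1 / c + 2) * τ * (M * (V / ‖y‖)) := by gcongr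
        _ = _ := by ring
    have hMW : 0 ≤ 4 * M * W := by positivity
    rcases le_total 1 τ with h1τ | h1τ
    · have : (1 + τ) * snorm 1 φ y ≤ 2 * τ * snorm 1 φ y :=
        mul_le_mul_of_nonneg_right (by linarith) hN
      linarith
    · have hyr' : 1 + r ≤ 2 * (1 + ‖y‖) := by
        have : r - τ ≤ a := le_abs_self _
        linarith
      have hVa : V ≤ (1 + a) ^ (1 - κ) :=
        calc V ≤ (1 + a) ^ (-κ) :=
              Real.rpow_le_rpow_of_nonpos (by linarith) (by linarith) (by linarith)
          _ ≤ _ := Real.rpow_le_rpow_of_exponent_le (by linarith) (by linarith)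
      have h3 : snorm 1 φ y ≤ 2 * M * W := by
        rw [hW, ← mul_div_assoc, le_div_iff₀ (by linarith)]
        calc snorm 1 φ y * (1 + r) ≤ snorm 1 φ y * (2 * (1 + ‖y‖)) := by gcongr
          _ ≤ 2 * (M * V) := by
              have : 0 ≤ ‖y‖ * |ψ y| := by positivity
              linarith
          _ ≤ 2 * (M * (1 + a) ^ (1 - κ)) := by gcongr
          _ = _ := by ring
      have h4 : (1 + τ) * snorm 1 φ y ≤ 2 * snorm 1 φ y :=
        mul_le_mul_of_nonneg_right (by linarith) hN
      have h5 : 0 ≤ 2 * τ * snorm 1 φ y := by positivity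
      linarith
  have hw : 1 + t + r ≤ (2 / c + 1) * (1 + r) := by
    have h1 : t ≤ 1 / c * (2 * r) := by
      rw [htτ]; exact mul_le_mul_of_nonneg_left hx.le hic.le
    have : 0 ≤ 2 / c := by positivity
    calc 1 + t + r ≤ 1 + 1 / c * (2 * r) + r := by linarith
      _ ≤ (2 / c + 1) * (1 + r) := by ring_nf; ring_nf at this; linarith
  calc (1 + t + r) * ((1 + a) ^ (κ - 1) * |u t x|)
      ≤ ((2 / c + 1) * (1 + r)) * ((1 + a) ^ (κ - 1) *
        (((1 / c + 2) * (2 + 1 / (κ - 1)) + 8) * M * W)) := by gcongr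
    _ = (2 / c + 1) * ((1 / c + 2) * (2 + 1 / (κ - 1)) + 8) * M *
        ((1 + a) ^ (κ - 1) * (1 + a) ^ (1 - κ)) := by
        rw [hW]; field_simp
    _ = (2 / c + 1) * ((1 / c + 2) * (2 + 1 / (κ - 1)) + 8) * M := by
        rw [← Real.rpow_add (by linarith)]
        simp

theorem stmt3 (c : ℝ) (hc : 0 < c) (κ : ℝ) (hκ : 1 < κ) :
    ∃ C > (0 : ℝ), ∀ (φ ψ : SFn) (u : Fn), ContDiff ℝ (⊤ : ℕ∞) φ → ContDiff ℝ (⊤ : ℕ∞) ψ →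
      IsFreeWaveSol c φ ψ u →
      ∀ (t : ℝ) (x : E3), 0 ≤ t →
        jb (t + ‖x‖) * jb (c * t - ‖x‖) ^ (κ - 1) * |u t x| ≤
          C * sSup {b : ℝ | ∃ y : E3, ‖y - x‖ ≤ c * t ∧
            b = jb ‖y‖ ^ κ * (jb ‖y‖ * snorm 1 φ y + ‖y‖ * |ψ y|)} := by
  have hκ' : 0 < κ - 1 := by linarith
  set C₁ := (2 / c + 1) * (2 / c + 2) with hC₁
  set C₂ := (2 / c + 1) * ((1 / c + 2) * (2 + 1 / (κ - 1)) + 8) with hC₂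
  have hC₁0 : 0 < C₁ := by positivity
  have hC₂0 : 0 < C₂ := by positivity
  refine ⟨(C₁ + C₂) * (2 ^ κ * 2), by positivity, fun φ ψ u hφ hψ h t x ht => ?_⟩
  set S := sSup {b : ℝ | ∃ y : E3, ‖y - x‖ ≤ c * t ∧
    b = jb ‖y‖ ^ κ * (jb ‖y‖ * snorm 1 φ y + ‖y‖ * |ψ y|)} with hS
  have hle : ∀ y : E3, ‖y - x‖ ≤ c * t →
      jb ‖y‖ ^ κ * (jb ‖y‖ * snorm 1 φ y + ‖y‖ * |ψ y|) ≤ S :=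
    fun y hy => le_csSup (bddAbove_weighted_data hφ hψ κ (c * t) x) ⟨y, hy, rfl⟩
  have hS0 : 0 ≤ S := by
    refine le_trans ?_ (hle x (by rw [sub_self, norm_zero]; positivity))
    have := jb_pos ‖x‖
    have := snorm_nonneg 1 φ x
    positivity
  have hM : ∀ y : E3, ‖y - x‖ ≤ c * t →
      (1 + ‖y‖) * snorm 1 φ y + ‖y‖ * |ψ y| ≤ 2 ^ κ * 2 * S * (1 + ‖y‖) ^ (-κ) := by
    intro y hy
    have hj := jb_pos ‖y‖
    have hN := snorm_nonneg 1 φ y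
    have h2 : 1 + ‖y‖ ≤ 2 * jb ‖y‖ := by simpa using le_two_mul_jb ‖y‖
    rw [Real.rpow_neg (by positivity), ← div_eq_mul_inv, le_div_iff₀ (by positivity)]
    have h3 : (1 + ‖y‖) ^ κ ≤ 2 ^ κ * jb ‖y‖ ^ κ := by
      rw [← Real.mul_rpow (by norm_num) hj.le]
      exact Real.rpow_le_rpow (by positivity) h2 (by linarith)
    have h4 : (1 + ‖y‖) * snorm 1 φ y + ‖y‖ * |ψ y| ≤
        2 * (jb ‖y‖ * snorm 1 φ y + ‖y‖ * |ψ y|) := by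
      have := mul_le_mul_of_nonneg_right h2 hN
      have : 0 ≤ ‖y‖ * |ψ y| := by positivity
      linarith
    calc ((1 + ‖y‖) * snorm 1 φ y + ‖y‖ * |ψ y|) * (1 + ‖y‖) ^ κ
        ≤ (2 * (jb ‖y‖ * snorm 1 φ y + ‖y‖ * |ψ y|)) * (2 ^ κ * jb ‖y‖ ^ κ) := by gcongr
      _ = 2 ^ κ * 2 * (jb ‖y‖ ^ κ * (jb ‖y‖ * snorm 1 φ y + ‖y‖ * |ψ y|)) := by ring
      _ ≤ 2 ^ κ * 2 * S := mul_le_mul_of_nonneg_left (hle y hy) (by positivity)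
  have hM0 : 0 ≤ 2 ^ κ * 2 * S := by positivity
  have hmain : (1 + t + ‖x‖) * ((1 + |‖x‖ - c * t|) ^ (κ - 1) * |u t x|) ≤
      (C₁ + C₂) * (2 ^ κ * 2 * S) := by
    have h1 := mul_nonneg hC₁0.le hM0
    have h2 := mul_nonneg hC₂0.le hM0
    rcases le_or_gt (2 * ‖x‖) (c * t) with hx | hx
    · have := h.decay_of_le hc hκ hφ hψ.continuous ht hM0 x hM hx
      linarith
    · have := h.decay_of_ge hc hκ hφ hψ.continuous ht hM0 x hM hx
      linarith
  have e1 : jb (t + ‖x‖) ≤ 1 + t + ‖x‖ := by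
    have := jb_le (t + ‖x‖)
    rwa [abs_of_nonneg (by positivity), ← add_assoc] at this
  have e2 : jb (c * t - ‖x‖) ^ (κ - 1) ≤ (1 + |‖x‖ - c * t|) ^ (κ - 1) := by
    refine Real.rpow_le_rpow (jb_pos _).le ?_ hκ'.le
    rw [abs_sub_comm]
    exact jb_le _
  have e3 := (jb_pos (c * t - ‖x‖)).le
  calc jb (t + ‖x‖) * jb (c * t - ‖x‖) ^ (κ - 1) * |u t x|
      ≤ (1 + t + ‖x‖) * (1 + |‖x‖ - c * t|) ^ (κ - 1) * |u t x| := by gcongr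
    _ ≤ (C₁ + C₂) * (2 ^ κ * 2 * S) := by rw [mul_assoc]; exact hmain
    _ = (C₁ + C₂) * (2 ^ κ * 2) * S := by ring


end PaperKatayama
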